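/- There is no ambient representation of (H, ⊞) with bracket-independent decoding: for every commutative monoid (K, ⊕), there do not exist an injective map ι : H → K and a map D : K → H such that (AR1) D ∘ ι = id on H, (AR2) D(ι(x) ⊕ ι(y)) ∈ x⊞y for all x, y ∈ H, and (AR3) D(ι(x) ⊕ ι(y) ⊕ ι(z)) ∈ ((x⊞y)⊞z) ∩ (x⊞(y⊞z)) for all x, y, z ∈ H. -/

import Mathlib

inductive Sgn : Type
  | pos | neg | lam
deriving DecidableEq

inductive H : Type
  | zero : H
  | elt (σ : Sgn) (a : ℝ) (ha : 0 < a) : H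

noncomputable def hadd : H → H → Set H
  | H.zero, x => {x}
  | x, H.zero => {x}
  | H.elt Sgn.pos a _, H.elt Sgn.pos b _ =>
      {H.elt Sgn.pos (a + b) (by linarith)}
  | H.elt Sgn.neg a _, H.elt Sgn.neg b _ =>
      {H.elt Sgn.neg (a + b) (by linarith)}
  | H.elt Sgn.pos a _, H.elt Sgn.neg b _ =>
      if h : b < a then {H.elt Sgn.pos (a - b) (by linarith)}
      else if h' : a = b then {H.zero}
      else {H.elt Sgn.neg (b - a)
        (by push_neg at h; exact sub_pos.mpr (lt_of_le_of_ne h h'))}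
  | H.elt Sgn.neg b _, H.elt Sgn.pos a _ =>
      if h : b < a then {H.elt Sgn.pos (a - b) (by linarith)}
      else if h' : a = b then {H.zero}
      else {H.elt Sgn.neg (b - a)
        (by push_neg at h; exact sub_pos.mpr (lt_of_le_of_ne h h'))}
  | H.elt Sgn.pos a _, H.elt Sgn.lam b _ => {H.elt Sgn.lam (a + b) (by linarith)}
  | H.elt Sgn.neg a _, H.elt Sgn.lam b _ => {H.elt Sgn.lam (a + b) (by linarith)}
  | H.elt Sgn.lam b _, H.elt Sgn.pos a _ => {H.elt Sgn.lam (a + b) (by linarith)}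
  | H.elt Sgn.lam b _, H.elt Sgn.neg a _ => {H.elt Sgn.lam (a + b) (by linarith)}
  | H.elt Sgn.lam a _, H.elt Sgn.lam b _ =>
      if h : a = b then {H.elt Sgn.lam (2 * a) (by linarith), H.zero}
      else {H.elt Sgn.lam (a + b) (by linarith),
            H.elt Sgn.pos |a - b| (abs_pos.mpr (sub_ne_zero.mpr h)),
            H.elt Sgn.neg |a - b| (abs_pos.mpr (sub_ne_zero.mpr h))}

/-- Left bracketing `(x ⊞ y) ⊞ z` of the triple hyper-sum. -/
noncomputable def haddL (x y z : H) : Set H := ⋃ u ∈ hadd x y, hadd u z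

/-- Right bracketing `x ⊞ (y ⊞ z)` of the triple hyper-sum. -/
noncomputable def haddR (x y z : H) : Set H := ⋃ v ∈ hadd y z, hadd x v

theorem stmt_19 {K : Type*} [AddCommMonoid K] :
    ¬ ∃ (ι : H → K) (D : K → H),
        Function.Injective ι ∧
        (∀ x : H, D (ι x) = x) ∧
        (∀ x y : H, D (ι x + ι y) ∈ hadd x y) ∧
        (∀ x y z : H, D (ι x + ι y + ι z) ∈ haddL x y z ∩ haddR x y z) := by
  rintro ⟨ι, D, -, -, -, h⟩
  obtain ⟨hL, hR⟩ := h (H.elt Sgn.pos 1 one_pos) (H.elt Sgn.neg 1 one_pos)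
    (H.elt Sgn.lam 1 one_pos)
  simp only [haddL, haddR, hadd, lt_irrefl, dite_true, dite_false, Set.mem_iUnion,
    Set.mem_singleton_iff, exists_prop, exists_eq_left] at hL hR
  rw [hL, H.elt.injEq] at hR
  norm_num at hR
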